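/- arXiv:2203.03185 — 6 statements merged into one kernel-verified Lean document; each statement's English description precedes it below -/
import Mathlib

section
/- Assume that for a ∈ {0,1} the pointwise loss decomposes as l_a(x) = (μ̂_a(x) − μ_a(x))² + v_a(x) with v_a : ℝ^p → ℝ nonnegative and measurable (v_a(x) is the conditional variance of the potential outcome Y(a) given x), and let σ_Y² ≥ 0 satisfy σ_Y² ≤ ∫v_a dF_b for all a, b ∈ {0,1} (σ_Y² is the minimum of the four expected variances). Define R_F = ∫l₁ dF₁ + ∫l₀ dF₀, R_CF = ∫l₁ dF₀ + ∫l₀ dF₁, and R_ATE(μ̂_a) = ∫((μ̂₁(x) − μ̂₀(x)) − (μ₁(x) − μ₀(x)))² dF(x). Then R_ATE(μ̂_a) ≤ 2·(R_F + R_CF − 2·σ_Y²). -/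
open MeasureTheory

/-- One-measure bound: the contrast error is controlled by the excess losses. -/
theorem contrast_bound {E : Type*} [MeasurableSpace E] (G : Measure E)
    (a₁ a₀ m₁ m₀ l₁ l₀ v₁ v₀ : E → ℝ)
    (ha₁ : Measurable a₁) (ha₀ : Measurable a₀) (hm₁ : Measurable m₁) (hm₀ : Measurable m₀)
    (hv₁ : Measurable v₁) (hv₀ : Measurable v₀)
    (hv₁n : ∀ x, 0 ≤ v₁ x) (hv₀n : ∀ x, 0 ≤ v₀ x)
    (hl₁ : Integrable l₁ G) (hl₀ : Integrable l₀ G)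
    (hd₁ : ∀ x, l₁ x = (a₁ x - m₁ x) ^ 2 + v₁ x)
    (hd₀ : ∀ x, l₀ x = (a₀ x - m₀ x) ^ 2 + v₀ x)
    (s : ℝ) (hs₁ : s ≤ ∫ x, v₁ x ∂G) (hs₀ : s ≤ ∫ x, v₀ x ∂G) :
    Integrable (fun x => ((a₁ x - a₀ x) - (m₁ x - m₀ x)) ^ 2) G ∧
    ∫ x, ((a₁ x - a₀ x) - (m₁ x - m₀ x)) ^ 2 ∂G
      ≤ 2 * ((∫ x, l₁ x ∂G) + (∫ x, l₀ x ∂G) - 2 * s) := by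
  have iv₁ : Integrable v₁ G := hl₁.mono' hv₁.aestronglyMeasurable (ae_of_all _ fun x => by
    rw [Real.norm_of_nonneg (hv₁n x), hd₁]; nlinarith [sq_nonneg (a₁ x - m₁ x)])
  have iv₀ : Integrable v₀ G := hl₀.mono' hv₀.aestronglyMeasurable (ae_of_all _ fun x => by
    rw [Real.norm_of_nonneg (hv₀n x), hd₀]; nlinarith [sq_nonneg (a₀ x - m₀ x)])
  have hb : ∀ x, ((a₁ x - a₀ x) - (m₁ x - m₀ x)) ^ 2
      ≤ 2 * ((l₁ x - v₁ x) + (l₀ x - v₀ x)) := fun x => by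
    rw [hd₁, hd₀]; nlinarith [sq_nonneg ((a₁ x - m₁ x) + (a₀ x - m₀ x))]
  have ib : Integrable (fun x => 2 * ((l₁ x - v₁ x) + (l₀ x - v₀ x))) G :=
    ((hl₁.sub iv₁).add (hl₀.sub iv₀)).const_mul 2
  have ii : Integrable (fun x => ((a₁ x - a₀ x) - (m₁ x - m₀ x)) ^ 2) G :=
    ib.mono' (by fun_prop) (ae_of_all _ fun x => by
      rw [Real.norm_of_nonneg (sq_nonneg _)]; exact hb x)
  refine ⟨ii, (integral_mono ii ib hb).trans ?_⟩
  have j₁ : Integrable (fun x => l₁ x - v₁ x) G := hl₁.sub iv₁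
  have j₀ : Integrable (fun x => l₀ x - v₀ x) G := hl₀.sub iv₀
  rw [integral_const_mul, integral_add j₁ j₀, integral_sub hl₁ iv₁,
    integral_sub hl₀ iv₀]
  linarith

/-- If the pointwise losses decompose as `l_a = (μ̂_a − μ_a)² + v_a` with
`v_a ≥ 0` measurable, and `0 ≤ σ_Y² ≤ ∫ v_a dF_b` for all `a, b ∈ {0,1}`, then with
`R_F = ∫l₁ dF₁ + ∫l₀ dF₀`, `R_CF = ∫l₁ dF₀ + ∫l₀ dF₁`, and
`R_ATE(μ̂_a) = ∫((μ̂₁ − μ̂₀) − (μ₁ − μ₀))² dF`, we have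
`R_ATE(μ̂_a) ≤ 2·(R_F + R_CF − 2·σ_Y²)`. -/
theorem stmt5 {p : ℕ} (hp : 1 ≤ p)
    (F₁ F₀ : Measure (EuclideanSpace ℝ (Fin p)))
    [IsProbabilityMeasure F₁] [IsProbabilityMeasure F₀]
    (P₁ P₀ : ℝ) (hP₁ : P₁ ∈ Set.Icc (0 : ℝ) 1) (hP₀ : P₀ ∈ Set.Icc (0 : ℝ) 1)
    (hPsum : P₁ + P₀ = 1)
    (F : Measure (EuclideanSpace ℝ (Fin p)))
    (hF : F = ENNReal.ofReal P₁ • F₁ + ENNReal.ofReal P₀ • F₀)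
    (μhat₁ μhat₀ μ₁ μ₀ : EuclideanSpace ℝ (Fin p) → ℝ)
    (hμhat₁ : Measurable μhat₁) (hμhat₀ : Measurable μhat₀)
    (hμ₁ : Measurable μ₁) (hμ₀ : Measurable μ₀)
    (l₁ l₀ : EuclideanSpace ℝ (Fin p) → ℝ)
    (hl₁meas : Measurable l₁) (hl₀meas : Measurable l₀)
    (hl₁nonneg : ∀ x, 0 ≤ l₁ x) (hl₀nonneg : ∀ x, 0 ≤ l₀ x)
    (hl₁F₀ : Integrable l₁ F₀) (hl₁F₁ : Integrable l₁ F₁)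
    (hl₀F₀ : Integrable l₀ F₀) (hl₀F₁ : Integrable l₀ F₁)
    (v₁ v₀ : EuclideanSpace ℝ (Fin p) → ℝ)
    (hv₁meas : Measurable v₁) (hv₀meas : Measurable v₀)
    (hv₁nonneg : ∀ x, 0 ≤ v₁ x) (hv₀nonneg : ∀ x, 0 ≤ v₀ x)
    (hdec₁ : ∀ x, l₁ x = (μhat₁ x - μ₁ x) ^ 2 + v₁ x)
    (hdec₀ : ∀ x, l₀ x = (μhat₀ x - μ₀ x) ^ 2 + v₀ x)
    (σY2 : ℝ) (hσY2 : 0 ≤ σY2)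
    (hσ₁₁ : σY2 ≤ ∫ x, v₁ x ∂F₁) (hσ₁₀ : σY2 ≤ ∫ x, v₁ x ∂F₀)
    (hσ₀₁ : σY2 ≤ ∫ x, v₀ x ∂F₁) (hσ₀₀ : σY2 ≤ ∫ x, v₀ x ∂F₀) :
    ∫ x, ((μhat₁ x - μhat₀ x) - (μ₁ x - μ₀ x)) ^ 2 ∂F
      ≤ 2 * ((∫ x, l₁ x ∂F₁ + ∫ x, l₀ x ∂F₀)
          + (∫ x, l₁ x ∂F₀ + ∫ x, l₀ x ∂F₁) - 2 * σY2) := by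
  obtain ⟨i₁, b₁⟩ := contrast_bound F₁ μhat₁ μhat₀ μ₁ μ₀ l₁ l₀ v₁ v₀ hμhat₁ hμhat₀ hμ₁ hμ₀
    hv₁meas hv₀meas hv₁nonneg hv₀nonneg hl₁F₁ hl₀F₁ hdec₁ hdec₀ σY2 hσ₁₁ hσ₀₁
  obtain ⟨i₀, b₀⟩ := contrast_bound F₀ μhat₁ μhat₀ μ₁ μ₀ l₁ l₀ v₁ v₀ hμhat₁ hμhat₀ hμ₁ hμ₀
    hv₁meas hv₀meas hv₁nonneg hv₀nonneg hl₁F₀ hl₀F₀ hdec₁ hdec₀ σY2 hσ₁₀ hσ₀₀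
  rw [hF, integral_add_measure (i₁.smul_measure ENNReal.ofReal_ne_top)
    (i₀.smul_measure ENNReal.ofReal_ne_top), integral_smul_measure, integral_smul_measure,
    ENNReal.toReal_ofReal hP₁.1, ENNReal.toReal_ofReal hP₀.1, smul_eq_mul, smul_eq_mul]
  have n₁₁ : 0 ≤ ∫ x, l₁ x ∂F₁ := integral_nonneg hl₁nonneg
  have n₁₀ : 0 ≤ ∫ x, l₁ x ∂F₀ := integral_nonneg hl₁nonneg
  have n₀₁ : 0 ≤ ∫ x, l₀ x ∂F₁ := integral_nonneg hl₀nonneg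
  have n₀₀ : 0 ≤ ∫ x, l₀ x ∂F₀ := integral_nonneg hl₀nonneg
  have c₁ := mul_le_mul_of_nonneg_left b₁ hP₁.1
  have c₀ := mul_le_mul_of_nonneg_left b₀ hP₀.1
  have d₁ := mul_le_mul_of_nonneg_right hP₁.2 (add_nonneg n₁₁ n₀₁)
  have d₀ := mul_le_mul_of_nonneg_right hP₀.2 (add_nonneg n₁₀ n₀₀)
  have e : P₁ * σY2 + P₀ * σY2 = σY2 := by rw [← add_mul, hPsum, one_mul]
  linarith
end

section
/- Assume l_a(x) ≥ (μ̂_a(x) − μ_a(x))² for all x ∈ ℝ^p and a ∈ {0,1} (the expected squared-error pointwise loss dominates the squared bias), and suppose C ≥ 0 is a constant such that the Koksma–Hlawka-type bounds |∫l_a dF − ∫l_a dF_a| ≤ C·√E(F_a, F) hold for a = 0 and a = 1. Then the expected loss in ATE estimation, R_ATE(μ̂_a) = ∫((μ̂₁(x) − μ̂₀(x)) − (μ₁(x) − μ₀(x)))² dF(x), satisfies R_ATE(μ̂_a) ≤ 2·(∫l₁ dF₁ + ∫l₀ dF₀ + C·(√E(F₁, F) + √E(F₀, F))). -/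
open MeasureTheory

/-- The energy distance between two Borel probability measures on `ℝ^p`:
`E(G,H) = 2·∫∫‖x−y‖ dG dH − ∫∫‖x−x′‖ dG dG − ∫∫‖y−y′‖ dH dH`. -/
noncomputable def energyDist {p : ℕ}
    (G H : Measure (EuclideanSpace ℝ (Fin p))) : ℝ :=
  2 * ∫ x, ∫ y, ‖x - y‖ ∂H ∂G - ∫ x, ∫ y, ‖x - y‖ ∂G ∂G - ∫ x, ∫ y, ‖x - y‖ ∂H ∂H

/-- If `l_a(x) ≥ (μ̂_a(x) − μ_a(x))²` for all `x` and `a ∈ {0,1}`, and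
`C ≥ 0` satisfies the Koksma–Hlawka-type bounds `|∫l_a dF − ∫l_a dF_a| ≤ C·√E(F_a, F)`
for `a = 0, 1`, then
`R_ATE(μ̂_a) = ∫((μ̂₁ − μ̂₀) − (μ₁ − μ₀))² dF
  ≤ 2·(∫l₁ dF₁ + ∫l₀ dF₀ + C·(√E(F₁,F) + √E(F₀,F)))`. -/
theorem stmt6 {p : ℕ} (hp : 1 ≤ p)
    (F₁ F₀ : Measure (EuclideanSpace ℝ (Fin p)))
    [IsProbabilityMeasure F₁] [IsProbabilityMeasure F₀]
    (hmom₁ : Integrable (fun x => ‖x‖) F₁) (hmom₀ : Integrable (fun x => ‖x‖) F₀)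
    (P₁ P₀ : ℝ) (hP₁ : P₁ ∈ Set.Icc (0 : ℝ) 1) (hP₀ : P₀ ∈ Set.Icc (0 : ℝ) 1)
    (hPsum : P₁ + P₀ = 1)
    (F : Measure (EuclideanSpace ℝ (Fin p)))
    (hF : F = ENNReal.ofReal P₁ • F₁ + ENNReal.ofReal P₀ • F₀)
    (μhat₁ μhat₀ μ₁ μ₀ : EuclideanSpace ℝ (Fin p) → ℝ)
    (hμhat₁ : Measurable μhat₁) (hμhat₀ : Measurable μhat₀)
    (hμ₁ : Measurable μ₁) (hμ₀ : Measurable μ₀)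
    (l₁ l₀ : EuclideanSpace ℝ (Fin p) → ℝ)
    (hl₁meas : Measurable l₁) (hl₀meas : Measurable l₀)
    (hl₁nonneg : ∀ x, 0 ≤ l₁ x) (hl₀nonneg : ∀ x, 0 ≤ l₀ x)
    (hl₁F₀ : Integrable l₁ F₀) (hl₁F₁ : Integrable l₁ F₁)
    (hl₀F₀ : Integrable l₀ F₀) (hl₀F₁ : Integrable l₀ F₁)
    (hdom₁ : ∀ x, (μhat₁ x - μ₁ x) ^ 2 ≤ l₁ x)
    (hdom₀ : ∀ x, (μhat₀ x - μ₀ x) ^ 2 ≤ l₀ x)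
    (C : ℝ) (hC : 0 ≤ C)
    (hKH₁ : |∫ x, l₁ x ∂F - ∫ x, l₁ x ∂F₁| ≤ C * Real.sqrt (energyDist F₁ F))
    (hKH₀ : |∫ x, l₀ x ∂F - ∫ x, l₀ x ∂F₀| ≤ C * Real.sqrt (energyDist F₀ F)) :
    ∫ x, ((μhat₁ x - μhat₀ x) - (μ₁ x - μ₀ x)) ^ 2 ∂F
      ≤ 2 * (∫ x, l₁ x ∂F₁ + ∫ x, l₀ x ∂F₀
          + C * (Real.sqrt (energyDist F₁ F) + Real.sqrt (energyDist F₀ F))) := by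
  have h1 : Integrable l₁ F := by
    rw [hF]
    exact (hl₁F₁.smul_measure ENNReal.ofReal_ne_top).add_measure
      (hl₁F₀.smul_measure ENNReal.ofReal_ne_top)
  have h0 : Integrable l₀ F := by
    rw [hF]
    exact (hl₀F₁.smul_measure ENNReal.ofReal_ne_top).add_measure
      (hl₀F₀.smul_measure ENNReal.ofReal_ne_top)
  have key : ∫ x, ((μhat₁ x - μhat₀ x) - (μ₁ x - μ₀ x)) ^ 2 ∂F
      ≤ ∫ x, 2 * (l₁ x + l₀ x) ∂F := by
    apply integral_mono_of_nonneg
    · exact Filter.Eventually.of_forall fun x => sq_nonneg _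
    · exact (h1.add h0).const_mul 2
    · refine Filter.Eventually.of_forall fun x => ?_
      have a := hdom₁ x
      have b := hdom₀ x
      show ((μhat₁ x - μhat₀ x) - (μ₁ x - μ₀ x)) ^ 2 ≤ 2 * (l₁ x + l₀ x)
      nlinarith [sq_nonneg ((μhat₁ x - μ₁ x) + (μhat₀ x - μ₀ x))]
  rw [integral_const_mul, integral_add h1 h0] at key
  have a := (abs_le.mp hKH₁).2
  have b := (abs_le.mp hKH₀).2
  linarith
end

section
/- Assume l_a(x) ≥ (μ̂_a(x) − μ_a(x))² for all x ∈ ℝ^p and a ∈ {0,1}, and suppose C ≥ 0 is a constant such that the Koksma–Hlawka-type bounds |∫l_a dF_n − ∫l_a dF_{n,a,w}| ≤ C·√E(F_{n,a,w}, F_n) hold for a = 0 and a = 1. Then the empirical loss in ATE estimation, R_{ATE,n}(μ̂_a) = (1/n)·Σᵢ ((μ̂₁(Xᵢ) − μ̂₀(Xᵢ)) − (μ₁(Xᵢ) − μ₀(Xᵢ)))², satisfies R_{ATE,n}(μ̂_a) ≤ 2·(R_F(μ̂₁,w) + R_F(μ̂₀,w) + C·(√E(F_{n,1,w}, F_n)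 + √E(F_{n,0,w}, F_n))). -/
open Finset

/-- Integral of `f` with respect to the weighted empirical measure
`F_{n,a,w} = (1/n_a)·Σᵢ wᵢ·1(Aᵢ = a)·δ_{Xᵢ}` of group `a` (with `n_a` passed as `na`). -/
noncomputable def wInt {p n : ℕ} (X : Fin n → EuclideanSpace ℝ (Fin p))
    (A : Fin n → ℕ) (w : Fin n → ℝ) (a na : ℕ)
    (f : EuclideanSpace ℝ (Fin p) → ℝ) : ℝ :=
  (na : ℝ)⁻¹ * ∑ i, (if A i = a then w i * f (X i) else 0)

/-- Integral of `f` with respect to the empirical measure `F_n = (1/n)·Σᵢ δ_{Xᵢ}`. -/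
noncomputable def empInt {p n : ℕ} (X : Fin n → EuclideanSpace ℝ (Fin p))
    (f : EuclideanSpace ℝ (Fin p) → ℝ) : ℝ :=
  (n : ℝ)⁻¹ * ∑ i, f (X i)

/-- The weighted energy distance `E(F_{n,a,w}, F_n)` between the weighted empirical
measure of group `a` and the full empirical measure. -/
noncomputable def wEnergy {p n : ℕ} (X : Fin n → EuclideanSpace ℝ (Fin p))
    (A : Fin n → ℕ) (w : Fin n → ℝ) (a na : ℕ) : ℝ :=
  2 / ((na : ℝ) * n) * ∑ i, ∑ j, (if A i = a then w i else 0) * ‖X i - X j‖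
    - ((na : ℝ) ^ 2)⁻¹ *
        ∑ i, ∑ j, (if A i = a ∧ A j = a then w i * w j else 0) * ‖X i - X j‖
    - ((n : ℝ) ^ 2)⁻¹ * ∑ i, ∑ j, ‖X i - X j‖

/-- If `l_a(x) ≥ (μ̂_a(x) − μ_a(x))²` for all `x` and `a ∈ {0,1}`, and
`C ≥ 0` satisfies `|∫l_a dF_n − ∫l_a dF_{n,a,w}| ≤ C·√E(F_{n,a,w}, F_n)` for `a = 0, 1`,
then the empirical ATE loss `R_{ATE,n}(μ̂_a) = (1/n)·Σᵢ((μ̂₁(Xᵢ)−μ̂₀(Xᵢ))−(μ₁(Xᵢ)−μ₀(Xᵢ)))²`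
satisfies `R_{ATE,n}(μ̂_a) ≤ 2·(R_F(μ̂₁,w) + R_F(μ̂₀,w) + C·(√E(F_{n,1,w},F_n) + √E(F_{n,0,w},F_n)))`. -/
theorem stmt7 {p n : ℕ} (hp : 1 ≤ p)
    (X : Fin n → EuclideanSpace ℝ (Fin p))
    (A : Fin n → ℕ) (hA : ∀ i, A i ≤ 1)
    (n₁ n₀ : ℕ) (hn₁ : n₁ = ∑ i, A i) (hn₀ : n₀ = n - n₁)
    (hn₁pos : 0 < n₁) (hn₀pos : 0 < n₀)
    (w : Fin n → ℝ) (hw : ∀ i, 0 ≤ w i)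
    (hw₁ : ∑ i, w i * (A i : ℝ) = n₁)
    (hw₀ : ∑ i, w i * (1 - (A i : ℝ)) = n₀)
    (μhat₁ μhat₀ μ₁ μ₀ : EuclideanSpace ℝ (Fin p) → ℝ)
    (hμhat₁ : Measurable μhat₁) (hμhat₀ : Measurable μhat₀)
    (hμ₁ : Measurable μ₁) (hμ₀ : Measurable μ₀)
    (l₁ l₀ : EuclideanSpace ℝ (Fin p) → ℝ)
    (hl₁meas : Measurable l₁) (hl₀meas : Measurable l₀)
    (hl₁nonneg : ∀ x, 0 ≤ l₁ x) (hl₀nonneg : ∀ x, 0 ≤ l₀ x)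
    (hdom₁ : ∀ x, (μhat₁ x - μ₁ x) ^ 2 ≤ l₁ x)
    (hdom₀ : ∀ x, (μhat₀ x - μ₀ x) ^ 2 ≤ l₀ x)
    (C : ℝ) (hC : 0 ≤ C)
    (hKH₁ : |empInt X l₁ - wInt X A w 1 n₁ l₁| ≤ C * Real.sqrt (wEnergy X A w 1 n₁))
    (hKH₀ : |empInt X l₀ - wInt X A w 0 n₀ l₀| ≤ C * Real.sqrt (wEnergy X A w 0 n₀)) :
    (n : ℝ)⁻¹ * ∑ i, ((μhat₁ (X i) - μhat₀ (X i)) - (μ₁ (X i) - μ₀ (X i))) ^ 2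
      ≤ 2 * (wInt X A w 1 n₁ l₁ + wInt X A w 0 n₀ l₀
          + C * (Real.sqrt (wEnergy X A w 1 n₁) + Real.sqrt (wEnergy X A w 0 n₀))) := by
  have key : (n : ℝ)⁻¹ * ∑ i, ((μhat₁ (X i) - μhat₀ (X i)) - (μ₁ (X i) - μ₀ (X i))) ^ 2
      ≤ 2 * (empInt X l₁ + empInt X l₀) := by
    have h : ∑ i, ((μhat₁ (X i) - μhat₀ (X i)) - (μ₁ (X i) - μ₀ (X i))) ^ 2
        ≤ 2 * (∑ i, l₁ (X i) + ∑ i, l₀ (X i)) := by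
      rw [← Finset.sum_add_distrib, Finset.mul_sum]
      refine Finset.sum_le_sum fun i _ => ?_
      nlinarith [hdom₁ (X i), hdom₀ (X i),
        sq_nonneg ((μhat₁ (X i) - μ₁ (X i)) + (μhat₀ (X i) - μ₀ (X i)))]
    have h2 := mul_le_mul_of_nonneg_left h (inv_nonneg.mpr (Nat.cast_nonneg (α := ℝ) n))
    unfold empInt
    linarith
  have h1 := (abs_le.mp hKH₁).2
  have h0 := (abs_le.mp hKH₀).2
  linarith
end

section
/- Assume additionally that n·wᵢ ≥ n_{Aᵢ} for every i (so that F_n ≤ F_{n,1,w} + F_{n,0,w} as measures), that for a ∈ {0,1} the pointwise loss decomposes as l_a(x) = (μ̂_a(x) − μ_a(x))² + v_a(x) with v_a nonnegative and measurable, and that σ_Y² ≥ 0 satisfies σ_Y² ≤ ∫v_a dF_{n,b,w} for all a, b ∈ {0,1}. Then the empirical loss in ATE estimation, R_{ATE,n}(μ̂_a) = (1/n)·Σᵢ ((μ̂₁(Xᵢ) − μ̂₀(Xᵢ)) − (μ₁(Xᵢ) − μ₀(Xᵢ)))², satisfies R_{ATE,n}(μ̂_a) ≤ 2·(R_F(μ̂₁,w)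 + R_F(μ̂₀,w) + R_CF(μ̂₁,w) + R_CF(μ̂₀,w) − 2·σ_Y²). -/
open Finset

/-- Assume `n·wᵢ ≥ n_{Aᵢ}` for every `i` (so that `F_n ≤ F_{n,1,w} + F_{n,0,w}`
as measures), that `l_a = (μ̂_a − μ_a)² + v_a` with `v_a ≥ 0` measurable, and that
`0 ≤ σ_Y² ≤ ∫v_a dF_{n,b,w}` for all `a, b ∈ {0,1}`. Then the empirical ATE loss
`R_{ATE,n}(μ̂_a) = (1/n)·Σᵢ((μ̂₁(Xᵢ)−μ̂₀(Xᵢ))−(μ₁(Xᵢ)−μ₀(Xᵢ)))²` satisfies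
`R_{ATE,n}(μ̂_a) ≤ 2·(R_F(μ̂₁,w) + R_F(μ̂₀,w) + R_CF(μ̂₁,w) + R_CF(μ̂₀,w) − 2·σ_Y²)`. -/
theorem stmt8 {p n : ℕ} (hp : 1 ≤ p)
    (X : Fin n → EuclideanSpace ℝ (Fin p))
    (A : Fin n → ℕ) (hA : ∀ i, A i ≤ 1)
    (n₁ n₀ : ℕ) (hn₁ : n₁ = ∑ i, A i) (hn₀ : n₀ = n - n₁)
    (hn₁pos : 0 < n₁) (hn₀pos : 0 < n₀)
    (w : Fin n → ℝ) (hw : ∀ i, 0 ≤ w i)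
    (hw₁ : ∑ i, w i * (A i : ℝ) = n₁)
    (hw₀ : ∑ i, w i * (1 - (A i : ℝ)) = n₀)
    (hwlb : ∀ i, (if A i = 1 then (n₁ : ℝ) else (n₀ : ℝ)) ≤ (n : ℝ) * w i)
    (μhat₁ μhat₀ μ₁ μ₀ : EuclideanSpace ℝ (Fin p) → ℝ)
    (hμhat₁ : Measurable μhat₁) (hμhat₀ : Measurable μhat₀)
    (hμ₁ : Measurable μ₁) (hμ₀ : Measurable μ₀)
    (l₁ l₀ : EuclideanSpace ℝ (Fin p) → ℝ)
    (hl₁meas : Measurable l₁) (hl₀meas : Measurable l₀)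
    (hl₁nonneg : ∀ x, 0 ≤ l₁ x) (hl₀nonneg : ∀ x, 0 ≤ l₀ x)
    (v₁ v₀ : EuclideanSpace ℝ (Fin p) → ℝ)
    (hv₁meas : Measurable v₁) (hv₀meas : Measurable v₀)
    (hv₁nonneg : ∀ x, 0 ≤ v₁ x) (hv₀nonneg : ∀ x, 0 ≤ v₀ x)
    (hdec₁ : ∀ x, l₁ x = (μhat₁ x - μ₁ x) ^ 2 + v₁ x)
    (hdec₀ : ∀ x, l₀ x = (μhat₀ x - μ₀ x) ^ 2 + v₀ x)
    (σY2 : ℝ) (hσY2 : 0 ≤ σY2)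
    (hσ₁₁ : σY2 ≤ wInt X A w 1 n₁ v₁) (hσ₁₀ : σY2 ≤ wInt X A w 0 n₀ v₁)
    (hσ₀₁ : σY2 ≤ wInt X A w 1 n₁ v₀) (hσ₀₀ : σY2 ≤ wInt X A w 0 n₀ v₀) :
    (n : ℝ)⁻¹ * ∑ i, ((μhat₁ (X i) - μhat₀ (X i)) - (μ₁ (X i) - μ₀ (X i))) ^ 2
      ≤ 2 * (wInt X A w 1 n₁ l₁ + wInt X A w 0 n₀ l₀
          + wInt X A w 0 n₀ l₁ + wInt X A w 1 n₁ l₀ - 2 * σY2) := by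
  have hn : (0 : ℝ) < n := by
    have : 0 < n := by omega
    exact_mod_cast this
  have h1 : (0 : ℝ) < n₁ := by exact_mod_cast hn₁pos
  have h0 : (0 : ℝ) < n₀ := by exact_mod_cast hn₀pos
  have hadd : ∀ (a na : ℕ) (l f v : EuclideanSpace ℝ (Fin p) → ℝ),
      (∀ x, l x = f x + v x) →
      wInt X A w a na l = wInt X A w a na f + wInt X A w a na v := by
    intro a na l f v h
    unfold wInt
    rw [← mul_add, ← Finset.sum_add_distrib]
    congr 1
    refine Finset.sum_congr rfl fun i _ => ?_
    split_ifs
    · rw [h]; ring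
    · simp
  have e11 := hadd 1 n₁ l₁ (fun x => (μhat₁ x - μ₁ x) ^ 2) v₁ hdec₁
  have e10 := hadd 0 n₀ l₁ (fun x => (μhat₁ x - μ₁ x) ^ 2) v₁ hdec₁
  have e01 := hadd 1 n₁ l₀ (fun x => (μhat₀ x - μ₀ x) ^ 2) v₀ hdec₀
  have e00 := hadd 0 n₀ l₀ (fun x => (μhat₀ x - μ₀ x) ^ 2) v₀ hdec₀
  have hdom : ∀ f : EuclideanSpace ℝ (Fin p) → ℝ, (∀ x, 0 ≤ f x) →
      (n : ℝ)⁻¹ * ∑ i, f (X i) ≤ wInt X A w 1 n₁ f + wInt X A w 0 n₀ f := by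
    intro f hf
    unfold wInt
    rw [Finset.mul_sum, Finset.mul_sum, Finset.mul_sum, ← Finset.sum_add_distrib]
    refine Finset.sum_le_sum fun i _ => ?_
    have key : ∀ m : ℝ, 0 < m → m ≤ n * w i →
        (n : ℝ)⁻¹ * f (X i) ≤ m⁻¹ * (w i * f (X i)) := by
      intro m hm hmw
      rw [← mul_assoc]
      refine mul_le_mul_of_nonneg_right ?_ (hf _)
      rw [inv_mul_eq_div, inv_eq_one_div, div_le_div_iff₀ hn hm]
      linarith
    have hb := hwlb i
    have hAi := hA i
    by_cases h : A i = 1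
    · simp only [h, if_true] at hb ⊢
      simpa using key _ h1 hb
    · have h' : A i = 0 := by omega
      simp only [h'] at hb ⊢
      simpa using key _ h0 (by simpa using hb)
  have d1 := hdom (fun x => (μhat₁ x - μ₁ x) ^ 2) (fun x => sq_nonneg _)
  have d0 := hdom (fun x => (μhat₀ x - μ₀ x) ^ 2) (fun x => sq_nonneg _)
  have hsq : (n : ℝ)⁻¹ * ∑ i, ((μhat₁ (X i) - μhat₀ (X i)) - (μ₁ (X i) - μ₀ (X i))) ^ 2
      ≤ 2 * ((n : ℝ)⁻¹ * ∑ i, (μhat₁ (X i) - μ₁ (X i)) ^ 2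
        + (n : ℝ)⁻¹ * ∑ i, (μhat₀ (X i) - μ₀ (X i)) ^ 2) := by
    rw [← mul_add, ← Finset.sum_add_distrib, mul_left_comm, Finset.mul_sum _ _ (2 : ℝ)]
    refine mul_le_mul_of_nonneg_left (Finset.sum_le_sum fun i _ => ?_) (by positivity)
    nlinarith [sq_nonneg ((μhat₁ (X i) - μ₁ (X i)) + (μhat₀ (X i) - μ₀ (X i)))]
  linarith
end

section
/- Assume l_a(x) ≥ (μ̂_a(x) − μ_a(x))² for all x ∈ ℝ^p and a ∈ {0,1}, and suppose C ≥ 0 is a constant such that |∫l_a dF_n − ∫l_a dF_{n,a,w}| ≤ C·√E(F_{n,a,w}, F_n) for a = 0, 1. If the weights exactly balance both groups against the full sample, i.e. E(F_{n,1,w}, F_n) = 0 and E(F_{n,0,w}, F_n) = 0, then the empirical loss in ATE estimation satisfies the tighter bound R_{ATE,n}(μ̂_a) = (1/n)·Σᵢ ((μ̂₁(Xᵢ) − μ̂₀(Xᵢ)) − (μ₁(Xᵢ) − μ₀(Xᵢ)))² ≤ 2·(R_F(μ̂₁,w) + R_F(μ̂₀,w)). -/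
open Finset

/-- If `l_a(x) ≥ (μ̂_a(x) − μ_a(x))²` for all `x` and `a ∈ {0,1}`, `C ≥ 0`
satisfies `|∫l_a dF_n − ∫l_a dF_{n,a,w}| ≤ C·√E(F_{n,a,w}, F_n)` for `a = 0, 1`, and the
weights exactly balance both groups (`E(F_{n,1,w}, F_n) = 0` and `E(F_{n,0,w}, F_n) = 0`),
then `R_{ATE,n}(μ̂_a) = (1/n)·Σᵢ((μ̂₁(Xᵢ)−μ̂₀(Xᵢ))−(μ₁(Xᵢ)−μ₀(Xᵢ)))²
  ≤ 2·(R_F(μ̂₁,w) + R_F(μ̂₀,w))`. -/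
theorem stmt9 {p n : ℕ} (hp : 1 ≤ p)
    (X : Fin n → EuclideanSpace ℝ (Fin p))
    (A : Fin n → ℕ) (hA : ∀ i, A i ≤ 1)
    (n₁ n₀ : ℕ) (hn₁ : n₁ = ∑ i, A i) (hn₀ : n₀ = n - n₁)
    (hn₁pos : 0 < n₁) (hn₀pos : 0 < n₀)
    (w : Fin n → ℝ) (hw : ∀ i, 0 ≤ w i)
    (hw₁ : ∑ i, w i * (A i : ℝ) = n₁)
    (hw₀ : ∑ i, w i * (1 - (A i : ℝ)) = n₀)
    (μhat₁ μhat₀ μ₁ μ₀ : EuclideanSpace ℝ (Fin p) → ℝ)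
    (hμhat₁ : Measurable μhat₁) (hμhat₀ : Measurable μhat₀)
    (hμ₁ : Measurable μ₁) (hμ₀ : Measurable μ₀)
    (l₁ l₀ : EuclideanSpace ℝ (Fin p) → ℝ)
    (hl₁meas : Measurable l₁) (hl₀meas : Measurable l₀)
    (hl₁nonneg : ∀ x, 0 ≤ l₁ x) (hl₀nonneg : ∀ x, 0 ≤ l₀ x)
    (hdom₁ : ∀ x, (μhat₁ x - μ₁ x) ^ 2 ≤ l₁ x)
    (hdom₀ : ∀ x, (μhat₀ x - μ₀ x) ^ 2 ≤ l₀ x)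
    (C : ℝ) (hC : 0 ≤ C)
    (hKH₁ : |empInt X l₁ - wInt X A w 1 n₁ l₁| ≤ C * Real.sqrt (wEnergy X A w 1 n₁))
    (hKH₀ : |empInt X l₀ - wInt X A w 0 n₀ l₀| ≤ C * Real.sqrt (wEnergy X A w 0 n₀))
    (hE₁ : wEnergy X A w 1 n₁ = 0) (hE₀ : wEnergy X A w 0 n₀ = 0) :
    (n : ℝ)⁻¹ * ∑ i, ((μhat₁ (X i) - μhat₀ (X i)) - (μ₁ (X i) - μ₀ (X i))) ^ 2
      ≤ 2 * (wInt X A w 1 n₁ l₁ + wInt X A w 0 n₀ l₀) := by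
  rw [hE₁, Real.sqrt_zero, mul_zero] at hKH₁
  rw [hE₀, Real.sqrt_zero, mul_zero] at hKH₀
  have h1 : empInt X l₁ = wInt X A w 1 n₁ l₁ :=
    sub_eq_zero.mp (abs_eq_zero.mp (le_antisymm hKH₁ (abs_nonneg _)))
  have h0 : empInt X l₀ = wInt X A w 0 n₀ l₀ :=
    sub_eq_zero.mp (abs_eq_zero.mp (le_antisymm hKH₀ (abs_nonneg _)))
  rw [← h1, ← h0]
  have hs : ∑ i, ((μhat₁ (X i) - μhat₀ (X i)) - (μ₁ (X i) - μ₀ (X i))) ^ 2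
      ≤ 2 * (∑ i, l₁ (X i) + ∑ i, l₀ (X i)) := by
    rw [← Finset.sum_add_distrib, Finset.mul_sum]
    refine Finset.sum_le_sum fun i _ => ?_
    nlinarith [hdom₁ (X i), hdom₀ (X i),
      sq_nonneg ((μhat₁ (X i) - μ₁ (X i)) + (μhat₀ (X i) - μ₀ (X i)))]
  have hn : (0 : ℝ) ≤ (n : ℝ)⁻¹ := by positivity
  calc _ ≤ (n : ℝ)⁻¹ * (2 * (∑ i, l₁ (X i) + ∑ i, l₀ (X i))) :=
        mul_le_mul_of_nonneg_left hs hn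
    _ = _ := by unfold empInt; ring
end

section
/- Let n = n₀ + n₁ with n₀, n₁ > 0, and for i = 1,…,n let Yᵢ ∈ ℝ, Aᵢ ∈ {0,1} with Σᵢ Aᵢ = n₁, weights wᵢ ≥ 0, and fitted outcome values Qᵢ⁰, Qᵢ¹ ∈ ℝ. Define hᵢ = wᵢ·Aᵢ·n/n₁ − wᵢ·(1−Aᵢ)·n/n₀ and, for ε ∈ ℝ and a ∈ {0,1}, the calibrated predictions Q̃ᵢᵃ(ε) = Qᵢᵃ + ε·(wᵢ·a·n/n₁ − wᵢ·(1−a)·n/n₀), so that Q̃ᵢ^{Aᵢ}(ε) = Qᵢ^{Aᵢ} + ε·hᵢ. Let the weighted-regularization objective as a function of ε be T(ε) = R + β·(1/n)·Σᵢ (Yᵢ − Q̃ᵢ^{Aᵢ}(ε))², where R ∈ ℝ does not depend on ε and β > 0. If ε̂ is a critical point of T, i.e. T′(ε̂) = 0, then the nonparametric estimating equation holds: (1/n)·Σᵢ ( Q̃ᵢ¹(ε̂) − Q̃ᵢ⁰(ε̂) + hᵢ·(Yᵢ − Q̃ᵢ^{Aᵢ}(ε̂)) − τ̂ ) = 0,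 where τ̂ = (1/n)·Σᵢ (Q̃ᵢ¹(ε̂) − Q̃ᵢ⁰(ε̂)) is the weighted-regularization estimator of the average treatment effect. -/
open Finset

/-- With calibrated predictions `Q̃ᵢᵃ(ε) = Qᵢᵃ + ε·(wᵢ·a·n/n₁ − wᵢ·(1−a)·n/n₀)`,
`hᵢ = wᵢ·Aᵢ·n/n₁ − wᵢ·(1−Aᵢ)·n/n₀`, and the weighted-regularization objective
`T(ε) = R + β·(1/n)·Σᵢ(Yᵢ − Q̃ᵢ^{Aᵢ}(ε))²`, any critical point `ε̂` of `T` makes the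
nonparametric estimating equation hold:
`(1/n)·Σᵢ(Q̃ᵢ¹(ε̂) − Q̃ᵢ⁰(ε̂) + hᵢ·(Yᵢ − Q̃ᵢ^{Aᵢ}(ε̂)) − τ̂) = 0`,
where `τ̂ = (1/n)·Σᵢ(Q̃ᵢ¹(ε̂) − Q̃ᵢ⁰(ε̂))`. -/
theorem stmt11 (n n₀ n₁ : ℕ) (hn : n = n₀ + n₁) (hn₀ : 0 < n₀) (hn₁ : 0 < n₁)
    (Y : Fin n → ℝ)
    (A : Fin n → ℕ) (hA : ∀ i, A i ≤ 1) (hsumA : ∑ i, A i = n₁)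
    (w : Fin n → ℝ) (hw : ∀ i, 0 ≤ w i)
    (Q : Fin n → ℕ → ℝ)
    (h : Fin n → ℝ)
    (hh : ∀ i, h i = w i * (A i : ℝ) * n / n₁ - w i * (1 - (A i : ℝ)) * n / n₀)
    (Qt : ℝ → Fin n → ℕ → ℝ)
    (hQt : ∀ ε i a, Qt ε i a
      = Q i a + ε * (w i * (a : ℝ) * n / n₁ - w i * (1 - (a : ℝ)) * n / n₀))
    (R β : ℝ) (hβ : 0 < β)
    (T : ℝ → ℝ)
    (hT : ∀ ε, T ε = R + β * ((n : ℝ)⁻¹ * ∑ i, (Y i - Qt ε i (A i)) ^ 2))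
    (εhat : ℝ) (hcrit : deriv T εhat = 0)
    (τhat : ℝ) (hτ : τhat = (n : ℝ)⁻¹ * ∑ i, (Qt εhat i 1 - Qt εhat i 0)) :
    (n : ℝ)⁻¹ * ∑ i,
        (Qt εhat i 1 - Qt εhat i 0 + h i * (Y i - Qt εhat i (A i)) - τhat) = 0 := by
  have hnpos : (n : ℝ) ≠ 0 := by
    have : n ≠ 0 := by omega
    exact_mod_cast this
  have hQA : ∀ ε i, Qt ε i (A i) = Q i (A i) + ε * h i := by
    intro ε i
    rw [hQt, hh]
  have hder : HasDerivAt T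
      (β * ((n : ℝ)⁻¹ * ∑ i, (-2) * (h i * (Y i - Qt εhat i (A i))))) εhat := by
    have hTeq : T = fun ε => R + β * ((n : ℝ)⁻¹ * ∑ i, (Y i - (Q i (A i) + ε * h i)) ^ 2) := by
      funext ε
      rw [hT]
      simp only [hQA]
    rw [hTeq]
    refine HasDerivAt.const_add R (HasDerivAt.const_mul β (HasDerivAt.const_mul _ ?_))
    refine HasDerivAt.fun_sum fun i _ => ?_
    have h1 : HasDerivAt (fun ε : ℝ => Y i - (Q i (A i) + ε * h i)) (-(1 * h i)) εhat :=
      (((hasDerivAt_id εhat).mul_const (h i)).const_add (Q i (A i))).const_sub (Y i)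
    have h2 := h1.fun_pow 2
    refine h2.congr_deriv ?_
    rw [hQA]
    push_cast
    ring
  have h0 := hder.deriv.symm.trans hcrit
  rw [← Finset.mul_sum] at h0
  have hS : ∑ i, h i * (Y i - Qt εhat i (A i)) = 0 := by
    simpa [hβ.ne', hnpos] using h0
  rw [Finset.sum_sub_distrib, Finset.sum_add_distrib, hS, hτ]
  simp only [Finset.sum_const, Finset.card_univ, Fintype.card_fin, nsmul_eq_mul]
  field_simp
  ring
end
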